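/- Let A = S¹ × [0,1] be the closed annulus and let 𝒜 be the (countable) collection of all simple piecewise-linear arcs from S¹ × {0} to S¹ × {1} whose breakpoints have rational coordinates (identifying S¹ = ℝ/ℤ) and whose linear pieces have rational slopes. Then there is no compact totally disconnected set E ⊂ int(A) that intersects every arc in 𝒜. More precisely: if E ⊂ int(A) is compact and disjoint from some continuous arc b from S¹ × {0} to S¹ × {1}, then E is disjoint from some arc in 𝒜. -/

import Mathlib

open Set unitInterval

/-- The closed annulus `S¹ × [0,1]`, inside `S¹ × ℝ` with `S¹ = ℝ/ℤ`. -/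
def Annulus : Set (AddCircle (1 : ℝ) × ℝ) := univ ×ˢ Icc (0 : ℝ) 1

/-- An arc in the annulus: a continuous injective path from the bottom boundary circle
to the top boundary circle, contained in the annulus. -/
def IsArc (γ : C(unitInterval, AddCircle (1 : ℝ) × ℝ)) : Prop :=
  Function.Injective γ ∧ Set.range γ ⊆ Annulus ∧ (γ 0).2 = 0 ∧ (γ 1).2 = 1

/-- The path `γ` is piecewise linear with rational data: it admits a continuous lift
`g : ℝ → ℝ × ℝ` to the universal cover which is affine on the intervals of a partition of
`[0,1]` by rational points, with rational values at the breakpoints (hence rational slopes). -/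
def IsRatPL (γ : C(unitInterval, AddCircle (1 : ℝ) × ℝ)) : Prop :=
  ∃ g : ℝ → ℝ × ℝ, Continuous g ∧
    (∀ s : unitInterval, γ s = (((g s).1 : AddCircle (1 : ℝ)), (g s).2)) ∧
    ∃ (n : ℕ) (t : Fin (n + 1) → ℝ), StrictMono t ∧ t 0 = 0 ∧ t (Fin.last n) = 1 ∧
      (∀ k : Fin (n + 1), ∃ q : ℚ, t k = (q : ℝ)) ∧
      (∀ k : Fin (n + 1), ∃ q r : ℚ, g (t k) = ((q : ℝ), (r : ℝ))) ∧
      (∀ k : Fin n, ∀ s ∈ Icc (t k.castSucc) (t k.succ),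
        g s = g (t k.castSucc) +
          ((s - t k.castSucc) / (t k.succ - t k.castSucc)) •
            (g (t k.succ) - g (t k.castSucc)))

/-- The universal covering projection of `S¹ × ℝ`. -/
def annulusProj (p : ℝ × ℝ) : AddCircle (1 : ℝ) × ℝ := ((p.1 : AddCircle (1 : ℝ)), p.2)

theorem continuous_annulusProj : Continuous annulusProj :=
  ((AddCircle.continuous_mk' (1 : ℝ)).comp continuous_fst).prodMk continuous_snd

theorem annulusProj_eq_iff {p q : ℝ × ℝ} :
    annulusProj p = annulusProj q ↔ (∃ m : ℤ, p.1 = q.1 + m) ∧ p.2 = q.2 := by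
  simp only [annulusProj, Prod.mk.injEq]
  refine and_congr_left fun _ => ?_
  rw [← sub_eq_zero, ← AddCircle.coe_sub, AddCircle.coe_eq_zero_iff]
  simp only [zsmul_eq_mul, mul_one]
  exact ⟨fun ⟨m, hm⟩ => ⟨m, by linarith⟩, fun ⟨m, hm⟩ => ⟨m, by linarith⟩⟩

/-- The point at parameter `θ` on the segment from `u / N` to `v / N`. -/
noncomputable def gridPoint (N : ℕ) (u v : ℤ × ℤ) (θ : ℝ) : ℝ × ℝ :=
  (((u.1 : ℝ) + θ * (v.1 - u.1)) / N, ((u.2 : ℝ) + θ * (v.2 - u.2)) / N)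

/-- `u` and `v` are neighbours in the grid `ℤ × {0, …, N}` and the edge joining them, scaled by
`1 / N` and projected to the annulus, avoids `E`. -/
def GridStep (N : ℕ) (E : Set (AddCircle (1 : ℝ) × ℝ)) (u v : ℤ × ℤ) : Prop :=
  |v.1 - u.1| + |v.2 - u.2| = 1 ∧ u.2 ∈ Icc (0 : ℤ) N ∧ v.2 ∈ Icc (0 : ℤ) N ∧
    ∀ θ ∈ Icc (0 : ℝ) 1, annulusProj (gridPoint N u v θ) ∉ E

/-- Piecewise-linear interpolation of the values `x 0, …, x n` at the nodes `0, …, n`. -/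
noncomputable def linearInterp (x : ℕ → ℝ) (n : ℕ) (τ : ℝ) : ℝ :=
  x 0 + ∑ k ∈ Finset.range n, max 0 (min 1 (τ - k)) * (x (k + 1) - x k)

theorem continuous_linearInterp (x : ℕ → ℝ) (n : ℕ) : Continuous (linearInterp x n) := by
  unfold linearInterp
  fun_prop

theorem linearInterp_of_le (x : ℕ → ℝ) {n : ℕ} {τ : ℝ} (h : n ≤ τ) :
    linearInterp x n τ = x n := by
  induction n with
  | zero => simp [linearInterp]
  | succ n ih =>
    push_cast at h
    have := ih (by linarith)
    unfold linearInterp at this ⊢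
    rw [Finset.sum_range_succ, ← add_assoc, this, min_eq_left (by linarith),
      max_eq_right zero_le_one]
    ring

theorem linearInterp_add (x : ℕ → ℝ) {n k : ℕ} (hk : k < n) {θ : ℝ} (h0 : 0 ≤ θ) (h1 : θ ≤ 1) :
    linearInterp x n (k + θ) = x k + θ * (x (k + 1) - x k) := by
  induction n, Nat.succ_le_of_lt hk using Nat.le_induction with
  | base =>
    have := linearInterp_of_le x (n := k) (τ := k + θ) (by linarith)
    unfold linearInterp at this ⊢
    rw [Finset.sum_range_succ, ← add_assoc, this, add_sub_cancel_left, min_eq_right h1,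
      max_eq_right h0]
  | succ m hm ih =>
    have hkm : k + 1 ≤ m := hm
    have := ih (by omega)
    unfold linearInterp at this ⊢
    have hkm' : ((k : ℝ) + 1) ≤ m := by exact_mod_cast hkm
    rw [Finset.sum_range_succ, ← add_assoc, this, min_eq_right (by linarith),
      max_eq_left (by linarith)]
    ring

theorem linearInterp_natCast (x : ℕ → ℝ) {n k : ℕ} (hk : k ≤ n) :
    linearInterp x n k = x k := by
  rcases hk.lt_or_eq with h | rfl
  · simpa using linearInterp_add x h le_rfl zero_le_one
  · exact linearInterp_of_le x le_rfl

/-- Two grid edges of a simple grid path meet, modulo horizontal translation, only where they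
have to. -/
theorem gridEdge_injective {a b c d : ℤ} {p q r s M : ℤ} {θ θ' : ℝ}
    (hθ : 0 ≤ θ) (hθ1 : θ < 1) (hθ' : 0 ≤ θ') (hθ1' : θ' < 1)
    (hpq : |p| + |q| = 1) (hrs : |r| + |s| = 1)
    (h1 : (a : ℝ) + θ * p = c + θ' * r + M) (h2 : (b : ℝ) + θ * q = d + θ' * s) :
    (θ = θ' ∧ a = c + M ∧ b = d) ∨
    (0 < θ ∧ 0 < θ' ∧ a + p = c + M ∧ b + q = d ∧ a = c + r + M ∧ b = d + s) := by
  have unit {x y : ℤ} (h : |x| + |y| = 1) :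
      (x = 1 ∧ y = 0) ∨ (x = -1 ∧ y = 0) ∨ (x = 0 ∧ y = 1) ∨ (x = 0 ∧ y = -1) := by
    have := abs_nonneg x
    have := abs_nonneg y
    grind
  have key1 {m : ℤ} {t : ℝ} (h : (m : ℝ) = t) (ht : -1 < t) (ht' : t < 1) : m = 0 := by
    have h1 : (-1 : ℝ) < m := by linarith
    have h2 : (m : ℝ) < 1 := by linarith
    have h3 : (-1 : ℤ) < m := by exact_mod_cast h1
    have h4 : m < 1 := by exact_mod_cast h2
    omega
  have key2 {m : ℤ} {t : ℝ} (h : (m : ℝ) = t) (ht : 0 ≤ t) (ht' : t < 2) : m = 0 ∨ m = 1 := by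
    have h1 : (0 : ℝ) ≤ m := by linarith
    have h2 : (m : ℝ) < 2 := by linarith
    have h3 : (0 : ℤ) ≤ m := by exact_mod_cast h1
    have h4 : m < 2 := by exact_mod_cast h2
    omega
  obtain ⟨X, hX⟩ : ∃ X : ℤ, X = c + M - a := ⟨_, rfl⟩
  obtain ⟨Y, hY⟩ : ∃ Y : ℤ, Y = d - b := ⟨_, rfl⟩
  have hX' : (X : ℝ) = θ * p - θ' * r := by rw [hX]; push_cast; linarith
  have hY' : (Y : ℝ) = θ * q - θ' * s := by rw [hY]; push_cast; linarith
  have same {m : ℤ} (h : (m : ℝ) = θ - θ') : m = 0 ∧ θ = θ' := by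
    have h0 := key1 h (by linarith) (by linarith)
    rw [h0, Int.cast_zero] at h
    exact ⟨h0, by linarith⟩
  have same_neg {m : ℤ} (h : (m : ℝ) = -θ + θ') : m = 0 ∧ θ = θ' := by
    have h0 := same (m := -m) (by push_cast; linarith)
    exact ⟨by omega, h0.2⟩
  have oppo {m : ℤ} (h : (m : ℝ) = θ + θ') : (m = 0 ∧ θ = θ') ∨ (m = 1 ∧ 0 < θ ∧ 0 < θ') := by
    rcases key2 h (by linarith) (by linarith) with h0 | h0
    · rw [h0, Int.cast_zero] at h
      exact .inl ⟨h0, by linarith⟩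
    · rw [h0, Int.cast_one] at h
      exact .inr ⟨h0, by linarith, by linarith⟩
  have oppo_neg {m : ℤ} (h : (m : ℝ) = -θ - θ') :
      (m = 0 ∧ θ = θ') ∨ (m = -1 ∧ 0 < θ ∧ 0 < θ') := by
    rcases oppo (m := -m) (by push_cast; linarith) with h0 | h0
    · exact .inl ⟨by omega, h0.2⟩
    · exact .inr ⟨by omega, h0.2⟩
  have mixed {m n : ℤ} (h : (m : ℝ) = θ ∨ (m : ℝ) = -θ) (h' : (n : ℝ) = θ' ∨ (n : ℝ) = -θ') :
      m = 0 ∧ n = 0 ∧ θ = θ' := by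
    have h0 : m = 0 := h.elim (key1 · (by linarith) hθ1) (key1 · (by linarith) (by linarith))
    have h0' : n = 0 := h'.elim (key1 · (by linarith) hθ1') (key1 · (by linarith) (by linarith))
    simp only [h0, h0', Int.cast_zero, zero_eq_neg] at h h'
    exact ⟨h0, h0', by grind⟩
  rcases unit hpq with ⟨rfl, rfl⟩ | ⟨rfl, rfl⟩ | ⟨rfl, rfl⟩ | ⟨rfl, rfl⟩ <;>
  rcases unit hrs with ⟨rfl, rfl⟩ | ⟨rfl, rfl⟩ | ⟨rfl, rfl⟩ | ⟨rfl, rfl⟩ <;>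
  simp only [Int.cast_one, Int.cast_zero, Int.cast_neg, mul_one, mul_zero, mul_neg, sub_zero,
    zero_sub, sub_neg_eq_add, zero_add, Int.cast_eq_zero] at hX' hY'
  · have := same hX'
    grind
  · exact (oppo hX').imp (fun h => ⟨h.2, by omega, by omega⟩)
      (fun h => ⟨h.2.1, h.2.2, by omega, by omega, by omega, by omega⟩)
  · have := mixed (.inl hX') (.inr hY')
    grind
  · have := mixed (.inl hX') (.inl hY')
    grind
  · exact (oppo_neg hX').imp (fun h => ⟨h.2, by omega, by omega⟩)
      (fun h => ⟨h.2.1, h.2.2, by omega, by omega, by omega, by omega⟩)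
  · have := same_neg hX'
    grind
  · have := mixed (.inr hX') (.inr hY')
    grind
  · have := mixed (.inr hX') (.inl hY')
    grind
  · have := mixed (.inl hY') (.inr hX')
    grind
  · have := mixed (.inl hY') (.inl hX')
    grind
  · have := same hY'
    grind
  · exact (oppo hY').imp (fun h => ⟨h.2, by omega, by omega⟩)
      (fun h => ⟨h.2.1, h.2.2, by omega, by omega, by omega, by omega⟩)
  · have := mixed (.inr hY') (.inr hX')
    grind
  · have := mixed (.inr hY') (.inl hX')
    grind
  · exact (oppo_neg hY').imp (fun h => ⟨h.2, by omega, by omega⟩)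
      (fun h => ⟨h.2.1, h.2.2, by omega, by omega, by omega, by omega⟩)
  · have := same_neg hY'
    grind

/-- A grid walk from the bottom to the top whose vertices are distinct modulo horizontal
translation by `N` traces out a rational piecewise-linear arc. -/
theorem exists_ratPL_arc_of_simple_walk {N : ℕ} (hN : 0 < N) {E : Set (AddCircle (1 : ℝ) × ℝ)}
    {n : ℕ} {u : ℕ → ℤ × ℤ} (h0 : (u 0).2 = 0) (hn : (u n).2 = N)
    (hstep : ∀ k < n, GridStep N E (u k) (u (k + 1)))
    (hinj : ∀ k ≤ n, ∀ l ≤ n, ∀ m : ℤ, (u k).1 = (u l).1 + m * N → (u k).2 = (u l).2 → k = l) :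
    ∃ a : C(unitInterval, AddCircle (1 : ℝ) × ℝ), IsArc a ∧ IsRatPL a ∧
      Disjoint (Set.range a) E := by
  have hNR : (0 : ℝ) < N := by exact_mod_cast hN
  have hn0 : 0 < n := by
    rcases Nat.eq_zero_or_pos n with rfl | h
    · omega
    · exact h
  have hnR : (0 : ℝ) < n := by exact_mod_cast hn0
  let g : ℝ → ℝ × ℝ := fun s =>
    (linearInterp (fun k => (u k).1) n (n * s) / N, linearInterp (fun k => (u k).2) n (n * s) / N)
  have hg : Continuous g := by
    have := continuous_linearInterp (fun k => ((u k).1 : ℝ)) n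
    have := continuous_linearInterp (fun k => ((u k).2 : ℝ)) n
    fun_prop
  have hgk {k : ℕ} (hk : k < n) {s θ : ℝ} (hs : n * s = k + θ) (h0 : 0 ≤ θ) (h1 : θ ≤ 1) :
      g s = gridPoint N (u k) (u (k + 1)) θ := by
    simp only [g, hs, gridPoint, linearInterp_add _ hk h0 h1]
  have hgv {k : ℕ} (hk : k ≤ n) : g (k / n) = (((u k).1 : ℝ) / N, ((u k).2 : ℝ) / N) := by
    simp only [g, mul_div_cancel₀ _ hnR.ne', linearInterp_natCast _ hk]
  have hpos (s : unitInterval) : ∃ (k : ℕ) (θ : ℝ), k < n ∧ 0 ≤ θ ∧ θ ≤ 1 ∧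
      n * (s : ℝ) = k + θ := by
    rcases s.2.2.lt_or_eq with h | h
    · refine ⟨⌊n * (s : ℝ)⌋₊, n * (s : ℝ) - ⌊n * (s : ℝ)⌋₊, ?_, ?_, ?_, by ring⟩
      · rw [Nat.floor_lt (mul_nonneg hnR.le s.2.1)]
        nlinarith
      · linarith [Nat.floor_le (mul_nonneg hnR.le s.2.1)]
      · linarith [Nat.lt_floor_add_one (n * (s : ℝ))]
    · refine ⟨n - 1, 1, by omega, zero_le_one, le_rfl, ?_⟩
      rw [h, Nat.cast_sub hn0]
      simp
  have hpos' (s : unitInterval) : ∃ (k : ℕ) (θ : ℝ), k ≤ n ∧ 0 ≤ θ ∧ θ < 1 ∧ (0 < θ → k < n) ∧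
      n * (s : ℝ) = k + θ := by
    obtain ⟨k, θ, hk, h0, h1, hs⟩ := hpos s
    rcases h1.lt_or_eq with h | h
    · exact ⟨k, θ, hk.le, h0, h, fun _ => hk, hs⟩
    · exact ⟨k + 1, 0, hk, le_rfl, one_pos, fun h => absurd h (lt_irrefl _), by
        push_cast; linarith⟩
  let w : ℕ → ℤ × ℤ := fun k => if k ≤ n then u k else ((u n).1, (u n).2 + 1)
  have hw {k : ℕ} (hk : k ≤ n) : w k = u k := if_pos hk
  have hwstep {k : ℕ} (hk : k ≤ n) : |(w (k + 1)).1 - (w k).1| + |(w (k + 1)).2 - (w k).2| = 1 := by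
    rcases hk.lt_or_eq with h | rfl
    · rw [hw hk, hw h]
      exact (hstep k h).1
    · simp [w]
  have hgw {k : ℕ} (hk : k ≤ n) {s θ : ℝ} (hs : n * s = k + θ) (h0 : 0 ≤ θ) (h1 : θ < 1)
      (hθ : 0 < θ → k < n) : g s = gridPoint N (w k) (w (k + 1)) θ := by
    rcases h0.lt_or_eq with h | rfl
    · rw [hw hk, hw (hθ h)]
      exact hgk (hθ h) hs h0 h1.le
    · rw [show s = k / n by field_simp; linarith, hgv hk, hw hk]
      simp [gridPoint]
  have hg_inj (s s' : unitInterval) (h : annulusProj (g s) = annulusProj (g s')) : s = s' := by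
    obtain ⟨k, θ, hk, hθ, hθ1, hθk, hs⟩ := hpos' s
    obtain ⟨l, θ', hl, hθ', hθ1', hθl, hs'⟩ := hpos' s'
    rw [hgw hk hs hθ hθ1 hθk, hgw hl hs' hθ' hθ1' hθl, annulusProj_eq_iff] at h
    obtain ⟨⟨m, h1⟩, h2⟩ := h
    simp only [gridPoint] at h1 h2
    field_simp at h1 h2
    rcases gridEdge_injective (a := (w k).1) (b := (w k).2) (c := (w l).1) (d := (w l).2)
      (M := m * N) hθ hθ1 hθ' hθ1' (hwstep hk) (hwstep hl) (by push_cast; linarith)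
      (by push_cast; linarith) with ⟨rfl, h3, h4⟩ | ⟨h3, h3', h4, h5, h6, h7⟩
    · rw [hw hk, hw hl] at h3 h4
      obtain rfl := hinj k hk l hl m h3 h4
      exact Subtype.ext (mul_left_cancel₀ hnR.ne' (hs.trans hs'.symm))
    · have e1 := hinj (k + 1) (hθk h3) l hl m
        (by rw [← hw (hθk h3), ← hw hl]; linarith) (by rw [← hw (hθk h3), ← hw hl]; linarith)
      have e2 := hinj k hk (l + 1) (hθl h3') m
        (by rw [← hw hk, ← hw (hθl h3')]; linarith) (by rw [← hw hk, ← hw (hθl h3')]; linarith)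
      omega
  refine ⟨⟨fun s => annulusProj (g s), continuous_annulusProj.comp
    (hg.comp continuous_subtype_val)⟩, ⟨fun s s' h => hg_inj s s' h, ?_, ?_, ?_⟩, ?_, ?_⟩
  · rintro _ ⟨s, rfl⟩
    obtain ⟨k, θ, hk, h0, h1, hs⟩ := hpos s
    refine ⟨mem_univ _, ?_⟩
    change (g s).2 ∈ Icc (0 : ℝ) 1
    rw [hgk hk hs h0 h1]
    obtain ⟨-, ⟨h2, h3⟩, ⟨h4, h5⟩, -⟩ := hstep k hk
    have h2' : (0 : ℝ) ≤ (u k).2 := by exact_mod_cast h2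
    have h3' : ((u k).2 : ℝ) ≤ N := by exact_mod_cast h3
    have h4' : (0 : ℝ) ≤ (u (k + 1)).2 := by exact_mod_cast h4
    have h5' : ((u (k + 1)).2 : ℝ) ≤ N := by exact_mod_cast h5
    simp only [gridPoint]
    refine ⟨div_nonneg (by nlinarith) hNR.le, (div_le_one hNR).2 (by nlinarith)⟩
  · change (g (0 : ℝ)).2 = 0
    have := hgv (Nat.zero_le n)
    simp only [Nat.cast_zero, zero_div] at this
    simp [this, h0]
  · change (g (1 : ℝ)).2 = 1
    have := hgv le_rfl
    rw [div_self hnR.ne'] at this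
    simp [this, hn, hNR.ne']
  · have hsucc (k : Fin n) : (((k.succ : Fin (n + 1)) : ℕ) : ℝ) / n -
        ((k.castSucc : Fin (n + 1)) : ℕ) / n = 1 / n := by
      simp only [Fin.val_succ, Fin.val_castSucc]
      push_cast
      ring
    refine ⟨g, hg, fun s => rfl, n, fun k => (k : ℕ) / n, ?_, by simp, by simp [hnR.ne'], ?_, ?_, ?_⟩
    · intro k l hkl
      have : ((k : ℕ) : ℝ) < (l : ℕ) := by exact_mod_cast hkl
      exact div_lt_div_of_pos_right this hnR
    · exact fun k => ⟨(k : ℕ) / n, by push_cast; rfl⟩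
    · intro k
      refine ⟨(u k).1 / N, (u k).2 / N, ?_⟩
      rw [hgv (Nat.lt_succ_iff.1 k.2)]
      push_cast
      rfl
    · rintro k s ⟨hs1, hs2⟩
      rw [hsucc, hgv k.castSucc.is_le, hgv k.succ.is_le]
      simp only [Fin.val_succ, Fin.val_castSucc, Nat.cast_add, Nat.cast_one] at hs1 hs2 ⊢
      rw [div_le_iff₀ hnR] at hs1
      rw [le_div_iff₀ hnR] at hs2
      rw [hgk k.2 (θ := n * s - k) (by ring) (by linarith) (by linarith)]
      simp only [gridPoint, Prod.mk_sub_mk, Prod.smul_mk, Prod.mk_add_mk, smul_eq_mul]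
      congr 1 <;> field_simp
  · rw [Set.disjoint_left]
    rintro _ ⟨s, rfl⟩
    obtain ⟨k, θ, hk, h0, h1, hs⟩ := hpos s
    change annulusProj (g s) ∉ E
    rw [hgk hk hs h0 h1]
    exact (hstep k hk).2.2.2 θ ⟨h0, h1⟩

theorem gridStep_translate {N : ℕ} (hN : 0 < N) {E : Set (AddCircle (1 : ℝ) × ℝ)} {u v : ℤ × ℤ}
    (m : ℤ) (h : GridStep N E u v) :
    GridStep N E (u.1 + m * N, u.2) (v.1 + m * N, v.2) := by
  obtain ⟨h1, h2, h3, h4⟩ := h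
  have hNR : (N : ℝ) ≠ 0 := by exact_mod_cast hN.ne'
  refine ⟨by simpa using h1, h2, h3, fun θ hθ => ?_⟩
  have h5 : annulusProj (gridPoint N (u.1 + m * N, u.2) (v.1 + m * N, v.2) θ) =
      annulusProj (gridPoint N u v θ) := by
    refine annulusProj_eq_iff.2 ⟨⟨m, ?_⟩, rfl⟩
    simp only [gridPoint]
    push_cast
    field_simp
    ring
  rw [h5]
  exact h4 θ hθ

/-- A shortest grid walk from the bottom to the top is simple, so an arc exists as soon as some
walk does. -/
theorem exists_ratPL_arc_of_walk {N : ℕ} (hN : 0 < N) {E : Set (AddCircle (1 : ℝ) × ℝ)}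
    (h : ∃ (n : ℕ) (u : ℕ → ℤ × ℤ), (u 0).2 = 0 ∧ (u n).2 = N ∧
      ∀ k < n, GridStep N E (u k) (u (k + 1))) :
    ∃ a : C(unitInterval, AddCircle (1 : ℝ) × ℝ), IsArc a ∧ IsRatPL a ∧
      Disjoint (Set.range a) E := by
  classical
  obtain ⟨u, h0, hn, hstep⟩ := Nat.find_spec h
  have hmin := fun m => Nat.find_min h (m := m)
  generalize Nat.find h = n at *
  have key (k l : ℕ) (hkl : k < l) (hl : l ≤ n) (m : ℤ) (h1 : (u k).1 = (u l).1 + m * N)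
      (h2 : (u k).2 = (u l).2) : False := by
    refine hmin (n - (l - k)) (by omega) ⟨fun j => if j ≤ k then u j else
      ((u (j + (l - k))).1 + m * N, (u (j + (l - k))).2), by simpa using h0, ?_, ?_⟩
    · by_cases hk : n - (l - k) ≤ k
      · have : n = l := by omega
        subst this
        simp only [if_pos hk]
        rw [show n - (n - k) = k by omega, h2, hn]
      · simp only [if_neg hk]
        rw [show n - (l - k) + (l - k) = n by omega, hn]
    · intro j hj
      rcases lt_trichotomy j k with hjk | rfl | hjk
      · simp only [if_pos hjk.le, if_pos (show j + 1 ≤ k from hjk)]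
        exact hstep j (by omega)
      · have := gridStep_translate hN m (hstep l (by omega))
        rw [← h1, ← h2] at this
        simp only [le_refl, if_true, if_neg (show ¬ j + 1 ≤ j by omega)]
        rwa [show j + 1 + (l - j) = l + 1 by omega]
      · simp only [if_neg (show ¬ j ≤ k by omega), if_neg (show ¬ j + 1 ≤ k by omega)]
        have := gridStep_translate hN m (hstep (j + (l - k)) (by omega))
        rwa [show j + (l - k) + 1 = j + 1 + (l - k) by omega] at this
  refine exists_ratPL_arc_of_simple_walk hN h0 hn hstep fun k hk l hl m h1 h2 => ?_
  rcases lt_trichotomy k l with hkl | hkl | hkl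
  · exact (key k l hkl hl m h1 h2).elim
  · exact hkl
  · exact (key l k hkl hk (-m) (by rw [h1]; ring) h2.symm).elim

/-- `v` can be joined to the bottom row of the grid by a grid walk avoiding `E`. -/
def GridReach (N : ℕ) (E : Set (AddCircle (1 : ℝ) × ℝ)) (v : ℤ × ℤ) : Prop :=
  ∃ (n : ℕ) (u : ℕ → ℤ × ℤ), (u 0).2 = 0 ∧ u n = v ∧ ∀ k < n, GridStep N E (u k) (u (k + 1))

theorem GridReach.of_snd_eq_zero {N : ℕ} {E : Set (AddCircle (1 : ℝ) × ℝ)} {v : ℤ × ℤ}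
    (h : v.2 = 0) : GridReach N E v :=
  ⟨0, fun _ => v, h, rfl, by simp⟩

theorem GridReach.step {N : ℕ} {E : Set (AddCircle (1 : ℝ) × ℝ)} {v w : ℤ × ℤ}
    (h : GridReach N E v) (hvw : GridStep N E v w) : GridReach N E w := by
  obtain ⟨n, u, h0, rfl, hstep⟩ := h
  refine ⟨n + 1, fun k => if k ≤ n then u k else w, by simpa using h0, by simp, fun k hk => ?_⟩
  rcases (Nat.lt_succ_iff.1 hk).lt_or_eq with h | rfl
  · simp only [if_pos h.le, if_pos (show k + 1 ≤ n from h)]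
    exact hstep k h
  · simpa using hvw

theorem GridReach.exists_ratPL_arc {N : ℕ} (hN : 0 < N) {E : Set (AddCircle (1 : ℝ) × ℝ)}
    {v : ℤ × ℤ} (hv : v.2 = N) (h : GridReach N E v) :
    ∃ a : C(unitInterval, AddCircle (1 : ℝ) × ℝ), IsArc a ∧ IsRatPL a ∧
      Disjoint (Set.range a) E := by
  obtain ⟨n, u, h0, rfl, hstep⟩ := h
  exact exists_ratPL_arc_of_walk hN ⟨n, u, h0, hv, hstep⟩

/-- A discrete crossing lemma. In a rectangular grid coloured `0` on the left side and `1` on the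
right side, a property `r` of vertices that holds on the bottom row and is constant on every cell
that is not monochromatic holds somewhere on the top row. -/
theorem exists_top_of_crossing {M N : ℕ} (c : ℕ → ℕ → ℤ) (r : ℕ → ℕ → Prop)
    (hleft : ∀ j ≤ N, c 0 j = 0) (hright : ∀ j ≤ N, c M j = 1) (hbot : ∀ i, r i 0)
    (hcell : ∀ i < M, ∀ j < N,
      (∀ i' ∈ Icc i (i + 1), ∀ j' ∈ Icc j (j + 1), c i' j' = c i j) ∨
      (∀ i' ∈ Icc i (i + 1), ∀ j' ∈ Icc j (j + 1), (r i' j' ↔ r i j))) :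
    ∃ i, r i N := by
  classical
  by_contra! htop
  let S : ℕ → ℤ := fun j => ∑ i ∈ Finset.range M, if r i j then c (i + 1) j - c i j else 0
  let w : ℕ → ℕ → ℤ := fun i j => if r i j then c i (j + 1) - c i j else 0
  have hS : ∀ j < N, S (j + 1) = S j := by
    intro j hj
    have hsum : S (j + 1) - S j = ∑ i ∈ Finset.range M, (w (i + 1) j - w i j) := by
      rw [← Finset.sum_sub_distrib]
      refine Finset.sum_congr rfl fun i hi => ?_
      have h1 : i ∈ Icc i (i + 1) := by simp
      have h2 : i + 1 ∈ Icc i (i + 1) := by simp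
      have h3 : j ∈ Icc j (j + 1) := by simp
      have h4 : j + 1 ∈ Icc j (j + 1) := by simp
      simp only [w]
      rcases hcell i (Finset.mem_range.1 hi) j hj with h | h
      · simp [h _ h1 _ h4, h _ h2 _ h3, h _ h2 _ h4]
      · simp only [h _ h1 _ h4, h _ h2 _ h3]
        split_ifs <;> ring
    rw [Finset.sum_range_sub (fun i => w i j)] at hsum
    simp only [w, hleft j hj.le, hleft (j + 1) hj, hright j hj.le, hright (j + 1) hj, sub_self,
      ite_self] at hsum
    linarith
  have hconst : ∀ j ≤ N, S j = S 0 := by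
    intro j
    induction j with
    | zero => simp
    | succ j ih => exact fun hj => (hS j hj).trans (ih (by omega))
  have h0 : S 0 = 1 := by
    simp only [S, hbot, if_true]
    rw [Finset.sum_range_sub (fun i => c i 0), hleft 0 N.zero_le, hright 0 N.zero_le, sub_zero]
  have hN : S N = 0 := by simp [S, htop]
  have := hconst N le_rfl
  omega

theorem gridStep_of_box {N : ℕ} (hN : 0 < N) {E : Set (AddCircle (1 : ℝ) × ℝ)} {a b c d : ℝ}
    (hfree : ∀ q : ℝ × ℝ, q.1 * N ∈ Icc a b → q.2 * N ∈ Icc c d → annulusProj q ∉ E)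
    {u v : ℤ × ℤ} (huv : |v.1 - u.1| + |v.2 - u.2| = 1)
    (hu1 : (u.1 : ℝ) ∈ Icc a b) (hu2 : (u.2 : ℝ) ∈ Icc c d) (hu : u.2 ∈ Icc (0 : ℤ) N)
    (hv1 : (v.1 : ℝ) ∈ Icc a b) (hv2 : (v.2 : ℝ) ∈ Icc c d) (hv : v.2 ∈ Icc (0 : ℤ) N) :
    GridStep N E u v := by
  have hNR : (N : ℝ) ≠ 0 := by exact_mod_cast hN.ne'
  refine ⟨huv, hu, hv, fun θ ⟨hθ0, hθ1⟩ => hfree _ ?_ ?_⟩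
  · simp only [gridPoint, div_mul_cancel₀ _ hNR]
    constructor <;> nlinarith [hu1.1, hu1.2, hv1.1, hv1.2]
  · simp only [gridPoint, div_mul_cancel₀ _ hNR]
    constructor <;> nlinarith [hu2.1, hu2.2, hv2.1, hv2.2]

theorem GridReach.of_box {N : ℕ} (hN : 0 < N) {E : Set (AddCircle (1 : ℝ) × ℝ)} {a b c d : ℝ}
    (hfree : ∀ q : ℝ × ℝ, q.1 * N ∈ Icc a b → q.2 * N ∈ Icc c d → annulusProj q ∉ E)
    {u v : ℤ × ℤ} (huv1 : |v.1 - u.1| ≤ 1) (huv2 : |v.2 - u.2| ≤ 1)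
    (hu1 : (u.1 : ℝ) ∈ Icc a b) (hu2 : (u.2 : ℝ) ∈ Icc c d) (hu : u.2 ∈ Icc (0 : ℤ) N)
    (hv1 : (v.1 : ℝ) ∈ Icc a b) (hv2 : (v.2 : ℝ) ∈ Icc c d) (hv : v.2 ∈ Icc (0 : ℤ) N)
    (h : GridReach N E u) : GridReach N E v := by
  have hw : GridReach N E (v.1, u.2) := by
    by_cases h1 : v.1 = u.1
    · rwa [h1]
    · refine h.step (gridStep_of_box hN hfree ?_ hu1 hu2 hu hv1 hu2 hu)
      have : 0 < |v.1 - u.1| := abs_pos.2 (sub_ne_zero.2 h1)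
      simp only [sub_self, abs_zero, add_zero]
      omega
  by_cases h2 : v.2 = u.2
  · rwa [← h2] at hw
  · refine hw.step (gridStep_of_box hN hfree ?_ hv1 hu2 hu hv1 hv2 hv)
    have : 0 < |v.2 - u.2| := abs_pos.2 (sub_ne_zero.2 h2)
    simp only [sub_self, abs_zero, zero_add]
    omega

/-- A compact totally disconnected set does not block grid walks from the bottom to the top. -/
theorem exists_gridReach_of_isTotallyDisconnected {E : Set (AddCircle (1 : ℝ) × ℝ)}
    (hE : IsClosed E) (htd : IsTotallyDisconnected E) :
    ∃ N : ℕ, 0 < N ∧ ∃ v : ℤ × ℤ, v.2 = N ∧ GridReach N E v := by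
  classical
  let B : Set (ℝ × ℝ) := Icc 0 (1 / 2) ×ˢ Icc 0 1
  have hB : IsCompact B := isCompact_Icc.prod isCompact_Icc
  let K : Set (ℝ × ℝ) := B ∩ annulusProj ⁻¹' E
  have hK : IsCompact K := hB.inter_right (hE.preimage continuous_annulusProj)
  have hinj : InjOn annulusProj B := by
    rintro p ⟨hp, -⟩ q ⟨hq, -⟩ hpq
    simp only [annulusProj, Prod.mk.injEq] at hpq
    refine Prod.ext ((AddCircle.coe_eq_coe_iff_of_mem_Ico (p := (1 : ℝ)) (a := 0) ?_ ?_).1 hpq.1)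
      hpq.2
    · exact ⟨hp.1, by linarith [hp.2]⟩
    · exact ⟨hq.1, by linarith [hq.2]⟩
  have hKtd : IsTotallyDisconnected K := by
    intro t htK ht
    have h1 := htd (annulusProj '' t) (by rintro _ ⟨p, hp, rfl⟩; exact (htK hp).2)
      (ht.image _ continuous_annulusProj.continuousOn)
    exact fun p hp q hq => hinj (htK hp).1 (htK hq).1
      (h1 (mem_image_of_mem _ hp) (mem_image_of_mem _ hq))
  have : CompactSpace K := isCompact_iff_compactSpace.1 hK
  have : TotallyDisconnectedSpace K := totallyDisconnectedSpace_subtype_iff.2 hKtd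
  obtain ⟨C, hC, hZC, hCO⟩ := exists_clopen_of_closed_subset_open
    (X := K) (Z := {p | (p : ℝ × ℝ).1 ≤ 1 / 6}) (U := {p | (p : ℝ × ℝ).1 < 1 / 3})
    (isClosed_le (by fun_prop) continuous_const) (isOpen_lt (by fun_prop) continuous_const)
    (fun p (hp : (p : ℝ × ℝ).1 ≤ 1 / 6) => show (p : ℝ × ℝ).1 < 1 / 3 by linarith)
  let U : Set (ℝ × ℝ) := (↑) '' C ∪ B ∩ {p | p.1 ≤ 1 / 6}
  let V : Set (ℝ × ℝ) := (↑) '' Cᶜ ∪ B ∩ {p | 1 / 3 ≤ p.1}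
  have hU : IsCompact U := (hC.isClosed.isCompact.image continuous_subtype_val).union
    (hB.inter_right (isClosed_le continuous_fst continuous_const))
  have hV : IsCompact V := (hC.compl.isClosed.isCompact.image continuous_subtype_val).union
    (hB.inter_right (isClosed_le continuous_const continuous_fst))
  have hUV : Disjoint U V := by
    rw [Set.disjoint_left]
    rintro p (⟨p, hp, rfl⟩ | ⟨hp, hp'⟩) (⟨q, hq, hqp⟩ | ⟨hq, hq'⟩)
    · exact hq (by rwa [Subtype.ext hqp])
    · have hp' : (p : ℝ × ℝ).1 < 1 / 3 := hCO hp
      have hq'' : 1 / 3 ≤ (p : ℝ × ℝ).1 := hq'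
      linarith
    · exact hq (hZC (by rw [mem_ofPred_eq, hqp]; exact hp'))
    · simp only [mem_ofPred_eq] at hp' hq'
      linarith
  have hKUV : K ⊆ U ∪ V := by
    intro p hp
    by_cases hpC : (⟨p, hp⟩ : K) ∈ C
    · exact .inl (.inl ⟨_, hpC, rfl⟩)
    · exact .inr (.inl ⟨_, hpC, rfl⟩)
  obtain ⟨ρ, hρ, hdisj⟩ := hUV.exists_thickenings hU hV.isClosed
  obtain ⟨M, hM0, hM⟩ : ∃ M : ℕ, 0 < M ∧ 1 / ((2 * M : ℕ) : ℝ) < ρ / 2 := by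
    obtain ⟨m, hm⟩ := exists_nat_one_div_lt (half_pos hρ)
    refine ⟨m + 1, m.succ_pos, lt_of_le_of_lt ?_ hm⟩
    push_cast
    exact one_div_le_one_div_of_le (by positivity) (by linarith)
  set N := 2 * M with hNM
  have hN : 0 < N := by omega
  have hNR : (0 : ℝ) < N := by exact_mod_cast hN
  have hNMR : (N : ℝ) = 2 * M := by rw [hNM]; push_cast; rfl
  refine ⟨N, hN, ?_⟩
  let vert : ℕ → ℕ → ℝ × ℝ := fun i j => (i / N, j / N)
  let c : ℕ → ℕ → ℤ := fun i j => if vert i j ∈ Metric.thickening (ρ / 2) U then 0 else 1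
  have hvB {i j : ℕ} (hi : i ≤ M) (hj : j ≤ N) : vert i j ∈ B := by
    have hi' : (i : ℝ) ≤ M := by exact_mod_cast hi
    have hj' : (j : ℝ) ≤ N := by exact_mod_cast hj
    refine ⟨⟨by positivity, ?_⟩, by positivity, ?_⟩
    · change (i : ℝ) / N ≤ 1 / 2
      rw [div_le_iff₀ hNR]; linarith
    · change (j : ℝ) / N ≤ 1
      rw [div_le_iff₀ hNR]; linarith
  have hcross := exists_top_of_crossing (M := M) (N := N) c
    (fun i j => GridReach N E ((i : ℤ), (j : ℤ))) ?_ ?_ ?_ ?_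
  · obtain ⟨i, hi⟩ := hcross
    exact ⟨_, rfl, hi⟩
  · intro j hj
    refine if_pos (Metric.self_subset_thickening (half_pos hρ) _ (.inr ⟨hvB M.zero_le hj, ?_⟩))
    simp [vert]
  · intro j hj
    refine if_neg fun h => Set.disjoint_left.1 hdisj
      (Metric.thickening_mono (half_le_self hρ.le) _ h)
      (Metric.self_subset_thickening hρ _ (.inr ⟨hvB le_rfl hj, ?_⟩))
    change 1 / 3 ≤ (M : ℝ) / N
    rw [le_div_iff₀ hNR]; linarith
  · exact fun i => .of_snd_eq_zero rfl
  intro i hi j hj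
  have hi' : (i : ℝ) + 1 ≤ M := by exact_mod_cast hi
  have hj' : (j : ℝ) + 1 ≤ N := by exact_mod_cast hj
  have cast_mem {k l : ℕ} (h : l ∈ Icc k (k + 1)) : (l : ℝ) ∈ Icc (k : ℝ) (k + 1) :=
    ⟨by exact_mod_cast h.1, by exact_mod_cast h.2⟩
  by_cases hfree : ∀ q : ℝ × ℝ, q.1 * N ∈ Icc (i : ℝ) (i + 1) → q.2 * N ∈ Icc (j : ℝ) (j + 1) →
      annulusProj q ∉ E
  · have key {k k' l l' : ℕ} (hk : k ∈ Icc i (i + 1)) (hk' : k' ∈ Icc i (i + 1))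
        (hl : l ∈ Icc j (j + 1)) (hl' : l' ∈ Icc j (j + 1)) :
        GridReach N E ((k : ℤ), (l : ℤ)) → GridReach N E ((k' : ℤ), (l' : ℤ)) := by
      have hk2 := cast_mem hk
      have hk2' := cast_mem hk'
      have hl2 := cast_mem hl
      have hl2' := cast_mem hl'
      simp only [mem_Icc] at hk hk' hl hl'
      refine GridReach.of_box hN hfree ?_ ?_ (by simpa using hk2) (by simpa using hl2) ?_
        (by simpa using hk2') (by simpa using hl2') ?_
      · rw [abs_le]; omega
      · rw [abs_le]; omega
      · rw [mem_Icc]; omega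
      · rw [mem_Icc]; omega
    exact .inr fun k hk l hl => ⟨key hk (by simp) hl (by simp), key (by simp) hk (by simp) hl⟩
  left
  push Not at hfree
  obtain ⟨q, hq1, hq2, hqE⟩ := hfree
  have hqB : q ∈ B := by
    refine ⟨⟨?_, ?_⟩, ?_, ?_⟩
    · exact nonneg_of_mul_nonneg_left (i.cast_nonneg.trans hq1.1) hNR
    · rw [← mul_le_mul_iff_left₀ hNR]; linarith [hq1.2]
    · exact nonneg_of_mul_nonneg_left (j.cast_nonneg.trans hq2.1) hNR
    · rw [← mul_le_mul_iff_left₀ hNR]; linarith [hq2.2]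
  have hclose {k l : ℕ} (hk : k ∈ Icc i (i + 1)) (hl : l ∈ Icc j (j + 1)) :
      dist (vert k l) q < ρ / 2 := by
    refine lt_of_le_of_lt ?_ hM
    have hk2 := cast_mem hk
    have hl2 := cast_mem hl
    rw [Prod.dist_eq, max_le_iff, Real.dist_eq, Real.dist_eq, abs_le, abs_le]
    simp only [vert]
    refine ⟨⟨?_, ?_⟩, ?_, ?_⟩ <;> rw [← mul_le_mul_iff_left₀ hNR] <;> field_simp <;>
      linarith [hk2.1, hk2.2, hl2.1, hl2.2, hq1.1, hq1.2, hq2.1, hq2.2]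
  rcases hKUV ⟨hqB, hqE⟩ with hq | hq
  · have h0 {k l : ℕ} (hk : k ∈ Icc i (i + 1)) (hl : l ∈ Icc j (j + 1)) : c k l = 0 :=
      if_pos (Metric.mem_thickening_iff.2 ⟨q, hq, hclose hk hl⟩)
    exact fun k hk l hl => (h0 hk hl).trans (h0 (by simp) (by simp)).symm
  · have h1 {k l : ℕ} (hk : k ∈ Icc i (i + 1)) (hl : l ∈ Icc j (j + 1)) : c k l = 1 :=
      if_neg fun h => Set.disjoint_left.1 hdisj (Metric.thickening_mono (half_le_self hρ.le) _ h)
        (Metric.mem_thickening_iff.2 ⟨q, hq, (hclose hk hl).trans (half_lt_self hρ)⟩)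
    exact fun k hk l hl => (h1 hk hl).trans (h1 (by simp) (by simp)).symm

/-- A path from the bottom to the top that avoids a closed set can be followed by a grid walk
avoiding that set. -/
theorem exists_gridReach_of_path {E : Set (AddCircle (1 : ℝ) × ℝ)} (hE : IsClosed E)
    (f : C(unitInterval, ℝ × ℝ)) (hf : ∀ s, (f s).2 ∈ Icc (0 : ℝ) 1) (h0 : (f 0).2 = 0)
    (h1 : (f 1).2 = 1) (hfE : ∀ s, annulusProj (f s) ∉ E) :
    ∃ N : ℕ, 0 < N ∧ ∃ v : ℤ × ℤ, v.2 = N ∧ GridReach N E v := by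
  obtain ⟨δ, hδ, hδE⟩ := (isCompact_range f.continuous).exists_thickening_subset_open
    (hE.preimage continuous_annulusProj).isOpen_compl
    (by rintro _ ⟨s, rfl⟩; exact hfE s)
  obtain ⟨m, hm⟩ := exists_nat_one_div_lt (show 0 < δ / 3 by linarith)
  obtain ⟨N, hNm⟩ : ∃ N : ℕ, N = m + 1 := ⟨_, rfl⟩
  have hN : 0 < N := by omega
  have hNR : (0 : ℝ) < N := by exact_mod_cast hN
  have hNδ : 3 < δ * N := by
    rw [div_lt_div_iff₀ (by positivity) (by norm_num)] at hm
    rw [hNm]; push_cast; linarith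
  obtain ⟨η, hη, hfη⟩ := Metric.uniformContinuous_iff.1
    (CompactSpace.uniformContinuous_of_continuous f.continuous) (1 / N) (by positivity)
  obtain ⟨n, hn⟩ := exists_nat_one_div_lt hη
  let s : ℕ → unitInterval := fun i => projIcc 0 1 zero_le_one ((i : ℝ) / (n + 1))
  have hs (i : ℕ) : dist (f (s i)) (f (s (i + 1))) < 1 / N := by
    refine hfη (lt_of_le_of_lt ?_ hn)
    rw [Subtype.dist_eq, Real.dist_eq]
    refine (abs_projIcc_sub_projIcc _).trans_eq ?_
    rw [abs_sub_comm, ← sub_div]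
    push_cast
    rw [add_sub_cancel_left, abs_of_pos (by positivity)]
  let v : ℕ → ℤ × ℤ := fun i => (⌊(f (s i)).1 * N⌋, ⌊(f (s i)).2 * N⌋)
  have hvN (i : ℕ) : (v i).2 ∈ Icc (0 : ℤ) N := by
    obtain ⟨h2, h3⟩ := hf (s i)
    refine ⟨Int.floor_nonneg.2 (by positivity), Int.floor_le_iff.2 ?_⟩
    push_cast
    nlinarith
  have hreach (i : ℕ) : GridReach N E (v i) := by
    induction i with
    | zero =>
      refine .of_snd_eq_zero ?_
      have : s 0 = 0 := by simp [s]
      simp [v, this, h0]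
    | succ i ih =>
      set p := f (s i) with hp
      set q := f (s (i + 1)) with hq
      have hpq := hs i
      rw [← hp, ← hq, Prod.dist_eq, max_lt_iff, Real.dist_eq, Real.dist_eq, lt_div_iff₀ hNR,
        lt_div_iff₀ hNR, ← abs_of_pos hNR, ← abs_mul, ← abs_mul, abs_lt, abs_lt]
        at hpq
      obtain ⟨⟨e1, e2⟩, e3, e4⟩ := hpq
      have a1 := Int.floor_le (p.1 * N)
      have a2 := Int.lt_floor_add_one (p.1 * N)
      have a3 := Int.floor_le (p.2 * N)
      have a4 := Int.lt_floor_add_one (p.2 * N)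
      have b1 := Int.floor_le (q.1 * N)
      have b2 := Int.lt_floor_add_one (q.1 * N)
      have b3 := Int.floor_le (q.2 * N)
      have b4 := Int.lt_floor_add_one (q.2 * N)
      have near {x y : ℤ} (h : (x : ℝ) < y + 2) (h' : (y : ℝ) < x + 2) : |x - y| ≤ 1 := by
        have h2 : x < y + 2 := by exact_mod_cast h
        have h3 : y < x + 2 := by exact_mod_cast h'
        rw [abs_le]; omega
      refine GridReach.of_box (a := p.1 * N - 2) (b := p.1 * N + 2) (c := p.2 * N - 2)
        (d := p.2 * N + 2) hN ?_ (near ?_ ?_) (near ?_ ?_) ⟨?_, ?_⟩ ⟨?_, ?_⟩ (hvN i)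
        ⟨?_, ?_⟩ ⟨?_, ?_⟩ (hvN (i + 1)) ih
      · rintro z ⟨hz1, hz2⟩ ⟨hz3, hz4⟩
        refine hδE (Metric.mem_thickening_iff.2 ⟨p, ⟨s i, rfl⟩, ?_⟩)
        rw [Prod.dist_eq, max_lt_iff, Real.dist_eq, Real.dist_eq, abs_lt, abs_lt]
        refine ⟨⟨?_, ?_⟩, ?_, ?_⟩ <;> rw [← mul_lt_mul_iff_left₀ hNR] <;> linarith
      all_goals simp only [v, ← hp, ← hq]; linarith
  refine ⟨N, hN, v (n + 1), ?_, hreach _⟩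
  have : s (n + 1) = 1 := by
    have : ((n : ℝ) + 1) ≠ 0 := by positivity
    simp [s, div_self this]
  simp [v, this, h1]

theorem exists_lift_of_path (b : C(unitInterval, AddCircle (1 : ℝ) × ℝ)) :
    ∃ f : C(unitInterval, ℝ × ℝ), ∀ s, annulusProj (f s) = b s := by
  obtain ⟨e, he⟩ := QuotientAddGroup.mk_surjective (b 0).1
  obtain ⟨Γ, hΓ, -⟩ := (AddCircle.isCoveringMap_coe (1 : ℝ)).exists_path_lifts
    ⟨fun s => (b s).1, continuous_fst.comp b.continuous⟩ e he.symm
  exact ⟨⟨fun s => (Γ s, (b s).2), Γ.continuous.prodMk (continuous_snd.comp b.continuous)⟩,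
    fun s => Prod.ext (congrFun hΓ s) rfl⟩

/-- No compact totally disconnected subset of the open annulus meets every rational
piecewise-linear arc; more precisely, a compact subset of the open annulus disjoint from some
continuous arc is disjoint from some rational piecewise-linear arc. -/
theorem stmt13 :
    (¬ ∃ E : Set (AddCircle (1 : ℝ) × ℝ), IsCompact E ∧ IsTotallyDisconnected E ∧
      E ⊆ interior Annulus ∧
      ∀ γ : C(unitInterval, AddCircle (1 : ℝ) × ℝ), IsArc γ → IsRatPL γ →
        (Set.range γ ∩ E).Nonempty) ∧
    (∀ (E : Set (AddCircle (1 : ℝ) × ℝ)) (b : C(unitInterval, AddCircle (1 : ℝ) × ℝ)),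
      IsCompact E → E ⊆ interior Annulus → IsArc b → Disjoint (Set.range b) E →
      ∃ a : C(unitInterval, AddCircle (1 : ℝ) × ℝ), IsArc a ∧ IsRatPL a ∧
        Disjoint (Set.range a) E) := by
  constructor
  · rintro ⟨E, hE, htd, -, hmeet⟩
    obtain ⟨N, hN, v, hv, hreach⟩ := exists_gridReach_of_isTotallyDisconnected hE.isClosed htd
    obtain ⟨a, ha, ha', haE⟩ := hreach.exists_ratPL_arc hN hv
    exact (hmeet a ha ha').ne_empty (Set.disjoint_iff_inter_eq_empty.1 haE)
  · rintro E b hE - ⟨-, hbA, hb0, hb1⟩ hbE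
    obtain ⟨f, hf⟩ := exists_lift_of_path b
    have hf2 (s : unitInterval) : (f s).2 = (b s).2 := congrArg Prod.snd (hf s)
    obtain ⟨N, hN, v, hv, hreach⟩ := exists_gridReach_of_path hE.isClosed f
      (fun s => by rw [hf2]; exact (hbA ⟨s, rfl⟩).2) ((hf2 0).trans hb0) ((hf2 1).trans hb1)
      (fun s => by rw [hf]; exact Set.disjoint_left.1 hbE ⟨s, rfl⟩)
    exact hreach.exists_ratPL_arc hN hv
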